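/- arXiv:1403.3521 — 2 statements merged into one kernel-verified Lean document; each statement's English description precedes it below -/
import Mathlib

section
/- Let D, D' ⊆ ℝ⁵ be 3-dimensional subspaces with dim(D ∩ V₀) = 2 and dim(D' ∩ V₀) = 1. Then {p ∈ ℝ⁴ : L(p) ∩ D ≠ {0}} ≠ {p ∈ ℝ⁴ : L(p) ∩ D' ≠ {0}}. -/
/-- The Lagrangian plane `L(p) ⊆ ℝ⁵` for `p = (p₁₁₁,p₁₁₂,p₁₂₂,p₂₂₂) ∈ ℝ⁴`. -/
def lagPlane (p : Fin 4 → ℝ) : Submodule ℝ (Fin 5 → ℝ) :=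
  Submodule.span ℝ {![1, 0, p 0, p 1, p 2], ![0, 1, p 1, p 2, p 3]}

/-- The vertical subspace `V₀ = {v ∈ ℝ⁵ : v₁ = v₂ = 0}`. -/
def vertical : Submodule ℝ (Fin 5 → ℝ) :=
  LinearMap.ker (LinearMap.proj (R := ℝ) (φ := fun _ : Fin 5 => ℝ) 0) ⊓
    LinearMap.ker (LinearMap.proj (R := ℝ) (φ := fun _ : Fin 5 => ℝ) 1)

theorem mem_vertical {v : Fin 5 → ℝ} : v ∈ vertical ↔ v 0 = 0 ∧ v 1 = 0 := by
  simp [vertical]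

theorem finrank_vertical : Module.finrank ℝ vertical = 3 := by
  have hker : vertical = LinearMap.ker (LinearMap.funLeft ℝ ℝ (![0, 1] : Fin 2 → Fin 5)) := by
    ext v
    simp [mem_vertical, funext_iff, LinearMap.funLeft_apply]
  have hsurj := LinearMap.funLeft_surjective_of_injective ℝ ℝ (![0, 1] : Fin 2 → Fin 5)
    (by decide)
  have h := LinearMap.finrank_range_add_finrank_ker
    (LinearMap.funLeft ℝ ℝ (![0, 1] : Fin 2 → Fin 5))
  rw [LinearMap.range_eq_top.2 hsurj, finrank_top, ← hker] at h
  simp at h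
  omega

theorem mem_lagPlane {p : Fin 4 → ℝ} {z : Fin 5 → ℝ} :
    z ∈ lagPlane p ↔ z 2 = z 0 * p 0 + z 1 * p 1 ∧ z 3 = z 0 * p 1 + z 1 * p 2 ∧
      z 4 = z 0 * p 2 + z 1 * p 3 := by
  rw [lagPlane, Submodule.mem_span_pair]
  constructor
  · rintro ⟨a, b, rfl⟩
    simp
  · rintro ⟨h2, h3, h4⟩
    refine ⟨z 0, z 1, ?_⟩
    ext i
    fin_cases i <;> simp [h2, h3, h4]

/-- The quasi-linear equations contain an affine hyperplane. -/
theorem exists_hyperplane_of_finrank_inf_vertical_eq_two {D : Submodule ℝ (Fin 5 → ℝ)}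
    (hD : Module.finrank ℝ D = 3) (hDv : Module.finrank ℝ ↥(D ⊓ vertical) = 2) :
    ∃ (n : Fin 4 → ℝ) (c : ℝ), n ≠ 0 ∧
      ∀ p : Fin 4 → ℝ, n 0 * p 0 + n 1 * p 1 + n 2 * p 2 + n 3 * p 3 = c →
        lagPlane p ⊓ D ≠ ⊥ := by
  obtain ⟨h, hh, hhv⟩ : ∃ h ∈ D, h ∉ vertical := by
    by_contra! hle
    rw [inf_eq_left.2 hle] at hDv
    omega
  obtain ⟨w, hw, hwD⟩ : ∃ w ∈ vertical, w ∉ D ⊓ vertical := by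
    by_contra! hle
    have := Submodule.finrank_mono (show vertical ≤ D ⊓ vertical from hle)
    rw [finrank_vertical] at this
    omega
  obtain ⟨φ, hφw, hφ⟩ := Submodule.exists_le_ker_of_notMem hwD
  have hker : D ⊓ vertical = LinearMap.ker φ ⊓ vertical := by
    refine Submodule.eq_of_le_of_finrank_le (le_inf hφ inf_le_right) ?_
    have hlt : LinearMap.ker φ ⊓ vertical < vertical :=
      lt_of_le_of_ne inf_le_right fun he => hφw (he.symm.le hw).1
    have := Submodule.finrank_lt_finrank_of_lt hlt
    rw [finrank_vertical] at this
    omega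
  obtain ⟨α, hα⟩ : ∃ α : Fin 5 → ℝ, ∀ z, φ z = ∑ i, z i * α i :=
    ⟨_, LinearMap.pi_apply_eq_sum_univ φ⟩
  simp only [Fin.sum_univ_five] at hα
  rw [mem_vertical] at hw hhv
  refine ⟨![h 0 * α 2, h 1 * α 2 + h 0 * α 3, h 1 * α 3 + h 0 * α 4, h 1 * α 4],
    h 2 * α 2 + h 3 * α 3 + h 4 * α 4, ?_, ?_⟩
  · intro hn
    have h0 : h 0 * α 2 = 0 := congrFun hn 0
    have h1 : h 1 * α 2 + h 0 * α 3 = 0 := congrFun hn 1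
    have h2 : h 1 * α 3 + h 0 * α 4 = 0 := congrFun hn 2
    have h3 : h 1 * α 4 = 0 := congrFun hn 3
    have hα0 : α 2 = 0 ∧ α 3 = 0 ∧ α 4 = 0 := by
      by_cases ha : h 0 = 0
      · have hb : h 1 ≠ 0 := fun hb => hhv ⟨ha, hb⟩
        simp_all
      · simp_all
    apply hφw
    rw [hα, hw.1, hw.2, hα0.1, hα0.2.1, hα0.2.2]
    ring
  · intro p hp
    simp only [Matrix.cons_val] at hp
    rw [Submodule.ne_bot_iff]
    let z : Fin 5 → ℝ := ![h 0, h 1, h 0 * p 0 + h 1 * p 1, h 0 * p 1 + h 1 * p 2,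
      h 0 * p 2 + h 1 * p 3]
    have hz : z - h ∈ D ⊓ vertical := by
      rw [hker]
      refine ⟨?_, mem_vertical.2 (by simp [z])⟩
      rw [SetLike.mem_coe, LinearMap.mem_ker, hα]
      simp only [z, Pi.sub_apply, Matrix.cons_val]
      linear_combination hp
    refine ⟨z, ⟨mem_lagPlane.2 (by simp [z]), ?_⟩, fun h0 => hhv ⟨congrFun h0 0, congrFun h0 1⟩⟩
    simpa using D.add_mem hz.1 hh

/-- The fully nonlinear equations satisfy a determinantal equation of Monge–Ampère type. -/
theorem exists_det_eq_zero_of_finrank_inf_vertical_eq_one {D : Submodule ℝ (Fin 5 → ℝ)}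
    (hD : Module.finrank ℝ D = 3) (hDv : Module.finrank ℝ ↥(D ⊓ vertical) = 1) :
    ∃ v r s : Fin 3 → ℝ, v ≠ 0 ∧ ∀ p : Fin 4 → ℝ, lagPlane p ⊓ D ≠ ⊥ →
      v 0 * ((p 1 - r 1) * (p 3 - s 2) - (p 2 - r 2) * (p 2 - s 1)) -
      v 1 * ((p 0 - r 0) * (p 3 - s 2) - (p 2 - r 2) * (p 1 - s 0)) +
      v 2 * ((p 0 - r 0) * (p 2 - s 1) - (p 1 - r 1) * (p 1 - s 0)) = 0 := by
  have htop : D ⊔ vertical = ⊤ := by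
    apply Submodule.eq_top_of_finrank_eq
    have := Submodule.finrank_sup_add_finrank_inf_eq D vertical
    rw [hD, hDv, finrank_vertical] at this
    simp
    omega
  have hlift : ∀ x : Fin 5 → ℝ, ∃ d ∈ D, d 0 = x 0 ∧ d 1 = x 1 := by
    intro x
    obtain ⟨d, hd, w, hw, rfl⟩ := Submodule.mem_sup.1 (htop ▸ Submodule.mem_top : x ∈ D ⊔ vertical)
    rw [mem_vertical] at hw
    exact ⟨d, hd, by simp [hw.1], by simp [hw.2]⟩
  obtain ⟨d, hd, hd0, hd1⟩ := hlift ![1, 0, 0, 0, 0]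
  obtain ⟨e, he, he0, he1⟩ := hlift ![0, 1, 0, 0, 0]
  simp only [Matrix.cons_val] at hd0 hd1 he0 he1
  obtain ⟨⟨v, hv⟩, hv0, hspan⟩ := finrank_eq_one_iff'.1 hDv
  have hvv := mem_vertical.1 hv.2
  refine ⟨![v 2, v 3, v 4], ![d 2, d 3, d 4], ![e 2, e 3, e 4], ?_, ?_⟩
  · intro h
    apply hv0
    ext i
    fin_cases i
    exacts [hvv.1, hvv.2, congrFun h 0, congrFun h 1, congrFun h 2]
  · intro p hp
    obtain ⟨z, ⟨hzL, hzD⟩, hz0⟩ := (Submodule.ne_bot_iff _).1 hp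
    obtain ⟨h2, h3, h4⟩ := mem_lagPlane.1 hzL
    have hu : z - z 0 • d - z 1 • e ∈ D ⊓ vertical :=
      ⟨D.sub_mem (D.sub_mem hzD (D.smul_mem _ hd)) (D.smul_mem _ he),
        mem_vertical.2 (by simp [hd0, hd1, he0, he1])⟩
    obtain ⟨t, ht⟩ := hspan ⟨_, hu⟩
    have ht' : t • v = z - z 0 • d - z 1 • e := congrArg Subtype.val ht
    have e2 := congrFun ht' 2
    have e3 := congrFun ht' 3
    have e4 := congrFun ht' 4
    simp only [Pi.smul_apply, Pi.sub_apply, smul_eq_mul, h2, h3, h4] at e2 e3 e4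
    simp only [Matrix.cons_val]
    by_cases hz : z 0 = 0
    · have hz1 : z 1 ≠ 0 := by
        intro hz1
        apply hz0
        ext i
        fin_cases i <;> simp [h2, h3, h4, hz, hz1]
      apply (mul_eq_zero.1 _).resolve_left hz1
      linear_combination
        ((p 1 - d 3) * v 4 - (p 2 - d 4) * v 3) * e2 -
        ((p 0 - d 2) * v 4 - (p 2 - d 4) * v 2) * e3 +
        ((p 0 - d 2) * v 3 - (p 1 - d 3) * v 2) * e4
    · apply (mul_eq_zero.1 _).resolve_left hz
      linear_combination
        -((p 2 - e 3) * v 4 - (p 3 - e 4) * v 3) * e2 +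
        ((p 1 - e 2) * v 4 - (p 3 - e 4) * v 2) * e3 -
        ((p 1 - e 2) * v 3 - (p 2 - e 3) * v 2) * e4

/-- The net of quadrics through the twisted cubic contains no quadric with a plane component. -/
theorem eq_zero_of_quadric_vanishes_on_plane {v : Fin 3 → ℝ} {n : Fin 4 → ℝ} (hn : n ≠ 0)
    (h : ∀ x y z w : ℝ, n 0 * x + n 1 * y + n 2 * z + n 3 * w = 0 →
      v 0 * (y * w - z ^ 2) - v 1 * (x * w - y * z) + v 2 * (x * z - y ^ 2) = 0) :
    v = 0 := by
  suffices hv : v 0 = 0 ∧ v 1 = 0 ∧ v 2 = 0 by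
    ext i
    fin_cases i
    exacts [hv.1, hv.2.1, hv.2.2]
  by_cases h0 : n 0 = 0
  · by_cases h3 : n 3 = 0
    · have hQ (x y z : ℝ) := h x (-n 2 * y) (n 1 * y) z (by rw [h0, h3]; ring)
      have v1 : v 1 = 0 := by linear_combination -hQ 1 0 1
      by_cases h1 : n 1 = 0
      · have h2 : n 2 ≠ 0 := by
          intro h2
          apply hn
          ext i
          fin_cases i
          exacts [h0, h1, h2, h3]
        have v2 : v 2 = 0 := by
          have := hQ 0 1 0
          simp_all
        have := hQ 0 1 1
        simp_all
      · have v2 : v 2 = 0 := by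
          apply (mul_eq_zero.1 _).resolve_left h1
          linear_combination (hQ 1 1 0 - hQ (-1) 1 0) / 2
        have := hQ 0 1 0
        simp_all
    · have hQ (x y z : ℝ) := h (n 3 * x) (n 3 * y) (n 3 * z) (-(n 0 * x + n 1 * y + n 2 * z))
        (by ring)
      have v0 : v 0 = 0 := by
        have := hQ 0 0 1
        simp_all
      have v2 : v 2 = 0 := by
        have := hQ 0 1 0
        simp_all
      have := hQ 0 1 1
      simp_all
  · have hQ (x y z : ℝ) := h (-(n 1 * x + n 2 * y + n 3 * z)) (n 0 * x) (n 0 * y) (n 0 * z)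
      (by ring)
    have v2 : v 2 = 0 := by
      have := hQ 1 0 0
      simp_all
    have v0 : v 0 = 0 := by
      have := hQ 0 1 0
      simp_all
    have := hQ 1 1 0
    simp_all

theorem exists_linear_form_eq {n : Fin 4 → ℝ} (hn : n ≠ 0) (c : ℝ) :
    ∃ p : Fin 4 → ℝ, n 0 * p 0 + n 1 * p 1 + n 2 * p 2 + n 3 * p 3 = c := by
  obtain ⟨i, hi⟩ := Function.ne_iff.1 hn
  refine ⟨Pi.single i (c / n i), ?_⟩
  have : n ⬝ᵥ Pi.single i (c / n i) = c := by
    rw [dotProduct_single, mul_div_cancel₀ _ hi]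
  simpa [dotProduct, Fin.sum_univ_four] using this

/-- A quasi-linear Goursat-type MAE (vertical part of dimension 2) and a fully
nonlinear one (vertical part of dimension 1) never coincide. -/
theorem quasilinear_ne_fully_nonlinear
    (D D' : Submodule ℝ (Fin 5 → ℝ))
    (hD3 : Module.finrank ℝ D = 3) (hD'3 : Module.finrank ℝ D' = 3)
    (hDv : Module.finrank ℝ ↥(D ⊓ vertical) = 2)
    (hD'v : Module.finrank ℝ ↥(D' ⊓ vertical) = 1) :
    {p : Fin 4 → ℝ | lagPlane p ⊓ D ≠ ⊥} ≠ {p : Fin 4 → ℝ | lagPlane p ⊓ D' ≠ ⊥} := by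
  intro heq
  obtain ⟨n, c, hn, hplane⟩ := exists_hyperplane_of_finrank_inf_vertical_eq_two hD3 hDv
  obtain ⟨v, r, s, hv, hdet⟩ := exists_det_eq_zero_of_finrank_inf_vertical_eq_one hD'3 hD'v
  obtain ⟨q, hq⟩ := exists_linear_form_eq hn c
  have hF (p : Fin 4 → ℝ) (hp : n 0 * p 0 + n 1 * p 1 + n 2 * p 2 + n 3 * p 3 = c) :=
    hdet p (heq.subset (hplane p hp))
  refine hv (eq_zero_of_quadric_vanishes_on_plane hn fun x y z w hxyzw => ?_)
  have hpos := hF ![q 0 + x, q 1 + y, q 2 + z, q 3 + w]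
    (by simp only [Matrix.cons_val]; linear_combination hq + hxyzw)
  have hneg := hF ![q 0 - x, q 1 - y, q 2 - z, q 3 - w]
    (by simp only [Matrix.cons_val]; linear_combination hq - hxyzw)
  simp only [Matrix.cons_val] at hpos hneg
  linear_combination (hpos + hneg) / 2 - hF q hq
end

section
/- For all real numbers k₁, k₂, k₃, all m ∈ {1,2,3} and all p = (p₁₁₁,p₁₁₂,p₁₂₂,p₂₂₂) ∈ ℝ⁴: L(p) ∩ D_m ≠ {0} if and only if p₁₁₁ + σ₁p₁₁₂ + σ₂p₁₂₂ + σ₃p₂₂₂ = 0. In particular the three 3-dimensional subspaces D₁, D₂, D₃ determine the same equation: {p : L(p) ∩ D₁ ≠ 0} = {p : L(p) ∩ D₂ ≠ 0} = {p : L(p) ∩ D₃ ≠ 0}. -/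
/-- If `κ` is a root of `t³ - σ₁t² + σ₂t - σ₃`, the plane `L(p)` meets the distribution attached to
`κ` nontrivially exactly when `p` solves the equation with coefficients `1, σ₁, σ₂, σ₃`. -/
theorem lagPlane_inf_ne_bot_iff {κ σ₁ σ₂ σ₃ : ℝ} (hκ : κ ^ 3 - σ₁ * κ ^ 2 + σ₂ * κ - σ₃ = 0)
    (p : Fin 4 → ℝ) :
    lagPlane p ⊓ (Submodule.span ℝ {![1, κ, 0, 0, 0]} ⊔
      Submodule.span ℝ {![0, 0, -(σ₁ - κ), 1, 0], ![0, 0, -σ₂, κ, 1]}) ≠ ⊥ ↔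
      p 0 + σ₁ * p 1 + σ₂ * p 2 + σ₃ * p 3 = 0 := by
  rw [Submodule.ne_bot_iff, lagPlane, ← Submodule.span_union, Set.singleton_union]
  simp only [Submodule.mem_inf, Submodule.mem_span_pair, Submodule.mem_span_triple]
  constructor
  · rintro ⟨x, ⟨⟨a, b, hx⟩, c, u, v, hy⟩, hx0⟩
    have hxy := hx.trans hy.symm
    have e (i : Fin 5) := congrFun hxy i
    have e0 := e 0
    have e1 := e 1
    have e2 := e 2
    have e3 := e 3
    have e4 := e 4
    simp at e0 e1 e2 e3 e4
    subst e0 e1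
    have ha : a ≠ 0 := by
      rintro rfl
      exact hx0 (by simp [← hx])
    refine (mul_eq_zero.mp ?_).resolve_left ha
    linear_combination e2 + (σ₁ - κ) * e3 + (σ₂ - κ * (σ₁ - κ)) * e4 - a * p 3 * hκ
  · intro hp
    refine ⟨(1 : ℝ) • ![1, 0, p 0, p 1, p 2] + κ • ![0, 1, p 1, p 2, p 3],
      ⟨⟨1, κ, rfl⟩, 1, p 1 - κ ^ 2 * p 3, p 2 + κ * p 3, ?_⟩, fun h0 => ?_⟩
    · ext i
      fin_cases i <;> simp
      · linear_combination -hp - p 3 * hκ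
      · ring
    · simpa using congrFun h0 0

/-- The three characteristic distributions `D₁, D₂, D₃` of the quasi-linear 3rd-order
MAE `p₁₁₁ + σ₁p₁₁₂ + σ₂p₁₂₂ + σ₃p₂₂₂ = 0` with symbol `(ξ₁+k₁ξ₂)(ξ₁+k₂ξ₂)(ξ₁+k₃ξ₂)`
all determine the same equation `𝓔_{D₁} = 𝓔_{D₂} = 𝓔_{D₃}`. -/
theorem three_distributions_same_equation
    (k1 k2 k3 : ℝ) (k : Fin 3 → ℝ) (hk : k = ![k1, k2, k3])
    (σ1 σ2 σ3 : ℝ)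
    (hσ1 : σ1 = k1 + k2 + k3) (hσ2 : σ2 = k1 * k2 + k1 * k3 + k2 * k3)
    (hσ3 : σ3 = k1 * k2 * k3)
    (h : Fin 3 → (Fin 5 → ℝ)) (hh : ∀ m, h m = ![1, k m, 0, 0, 0])
    (V : Fin 3 → Submodule ℝ (Fin 5 → ℝ))
    (hV : ∀ m, V m = Submodule.span ℝ
      {![0, 0, -(σ1 - k m), 1, 0], ![0, 0, -σ2, k m, 1]})
    (D : Fin 3 → Submodule ℝ (Fin 5 → ℝ))
    (hD : ∀ m, D m = Submodule.span ℝ {h m} ⊔ V m) :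
    (∀ (m : Fin 3) (p : Fin 4 → ℝ),
      lagPlane p ⊓ D m ≠ ⊥ ↔ p 0 + σ1 * p 1 + σ2 * p 2 + σ3 * p 3 = 0) ∧
    {p : Fin 4 → ℝ | lagPlane p ⊓ D 0 ≠ ⊥} = {p : Fin 4 → ℝ | lagPlane p ⊓ D 1 ≠ ⊥} ∧
    {p : Fin 4 → ℝ | lagPlane p ⊓ D 1 ≠ ⊥} = {p : Fin 4 → ℝ | lagPlane p ⊓ D 2 ≠ ⊥} := by
  have key (m : Fin 3) (p : Fin 4 → ℝ) :
      lagPlane p ⊓ D m ≠ ⊥ ↔ p 0 + σ1 * p 1 + σ2 * p 2 + σ3 * p 3 = 0 := by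
    rw [hD, hh, hV]
    apply lagPlane_inf_ne_bot_iff
    subst hk hσ1 hσ2 hσ3
    fin_cases m <;> simp <;> ring
  exact ⟨key, Set.ext fun p => (key 0 p).trans (key 1 p).symm,
    Set.ext fun p => (key 1 p).trans (key 2 p).symm⟩
end
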